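/- There exists an absolute constant c > 0 with the following property. Let n ≥ 2 be a power of two, let a well-structured 3-CNF formula with n variables and m ≥ 1 clauses and an integer γ > 3 be given, with C_pos1^(i), C_pos2^(i), C_neg^(i) and Z as defined. Then there exist natural numbers p, q ≤ c·log₂ n, a matrix A ∈ ℤ^{q×(3+p+4)}, a vector b ∈ ℤ^q, and an injective function β : {0,…,n−1} → ℤ_{≥0}^p such that the solution set S := { x ∈ ℤ_{≥0}^{3+p+4} : A x ≤ b } has exactly 5n elements, namely S = { (α_t(i), β(i), χ_t) : i ∈ {0,…,n−1}, t ∈ {1,…,5} }, where the first three coordinates are α_1(i) = (C_pos1^(i), γ^i, 0), α_2(i) = (C_pos2^(i), γ^i, 0), α_3(i) = (C_neg^(i), 2γ^i, 0), α_4(i) = (0, γ^i, 1), α_5(i) = (0, 0, 1), and the last four coordinates χ_t ∈ {0,1}^4 equal the t-th standard unit vector for t ∈ {1,2,3,4} and the zero vector for t = 5. -/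

import Mathlib

/-- A 3-CNF formula: a list of clauses, each a list of at most three literals.
A literal is a pair `(i, pol)` where `i` is a variable index (below `numVars`)
and `pol = true` means the positive literal `v i`, `pol = false` its negation. -/
structure Cnf3 where
  numVars : ℕ
  clauses : List (List (ℕ × Bool))
  clause_len : ∀ C ∈ clauses, C.length ≤ 3
  vars_lt : ∀ C ∈ clauses, ∀ l ∈ C, l.1 < numVars

namespace Cnf3

/-- The number of clauses. -/
def numClauses (φ : Cnf3) : ℕ := φ.clauses.length

/-- A literal evaluates to true under assignment `a`. -/
def LitSat (a : ℕ → Bool) (l : ℕ × Bool) : Prop :=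
  (if l.2 then a l.1 else !a l.1) = true

/-- The formula is satisfiable: some assignment makes every clause contain a true literal. -/
def Satisfiable (φ : Cnf3) : Prop :=
  ∃ a : ℕ → Bool, ∀ C ∈ φ.clauses, ∃ l ∈ C, LitSat a l

/-- The number of occurrences (with multiplicity over all clauses) of variable `i`
with polarity `pos`. -/
def occCount (φ : Cnf3) (i : ℕ) (pos : Bool) : ℕ :=
  (φ.clauses.map fun C => C.countP fun l => l.1 == i && l.2 == pos).sum

/-- A formula is well-structured if every variable occurs, counted with multiplicity,
exactly twice positively and exactly once negatively. -/
def WellStructured (φ : Cnf3) : Prop :=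
  ∀ i < φ.numVars, φ.occCount i true = 2 ∧ φ.occCount i false = 1

/-- The number of occurrences of variable `i` with polarity `pos` inside the `c`-th clause. -/
def clauseOcc (φ : Cnf3) (c i : ℕ) (pos : Bool) : ℕ :=
  (φ.clauses.getD c []).countP fun l => l.1 == i && l.2 == pos

end Cnf3


/-! ### Affine functionals and linear systems -/

section LinSys
variable {V : Type} [Fintype V]

/-- Affine functional. -/
def IsAff (f : (V → ℤ) → ℤ) : Prop := ∃ (a : V → ℤ) (c : ℤ), ∀ x, f x = (∑ i, a i * x i) + c

theorem IsAff.coord (v : V) : IsAff (fun x : V → ℤ => x v) := by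
  classical
  exact ⟨fun i => if i = v then 1 else 0, 0, fun x => by simp⟩

theorem IsAff.const (c : ℤ) : IsAff (fun _ : V → ℤ => c) :=
  ⟨fun _ => 0, c, fun x => by simp⟩

theorem IsAff.sum {f g : (V → ℤ) → ℤ} (hf : IsAff f) (hg : IsAff g) :
    IsAff (fun x => f x + g x) := by
  obtain ⟨a, c, h⟩ := hf
  obtain ⟨a', c', h'⟩ := hg
  refine ⟨fun i => a i + a' i, c + c', fun x => ?_⟩
  simp only [h, h', add_mul, Finset.sum_add_distrib]
  ring

theorem IsAff.smul {f : (V → ℤ) → ℤ} (k : ℤ) (hf : IsAff f) : IsAff (fun x => k * f x) := by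
  obtain ⟨a, c, h⟩ := hf
  refine ⟨fun i => k * a i, k * c, fun x => ?_⟩
  simp only [h, mul_add, Finset.mul_sum, mul_assoc]

theorem IsAff.diff {f g : (V → ℤ) → ℤ} (hf : IsAff f) (hg : IsAff g) :
    IsAff (fun x => f x - g x) := by
  obtain ⟨a, c, h⟩ := hf
  obtain ⟨a', c', h'⟩ := hg
  refine ⟨fun i => a i - a' i, c - c', fun x => ?_⟩
  simp only [h, h', sub_mul, Finset.sum_sub_distrib]
  ring

/-- `P` is described by exactly `q` linear inequalities. -/
def IsLin (q : ℕ) (P : (V → ℤ) → Prop) : Prop :=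
  ∃ l : List ((V → ℤ) × ℤ), l.length = q ∧ ∀ x, P x ↔ ∀ e ∈ l, ∑ i, e.1 i * x i ≤ e.2

theorem IsLin.le {f g : (V → ℤ) → ℤ} (hf : IsAff f) (hg : IsAff g) :
    IsLin 1 (fun x => f x ≤ g x) := by
  obtain ⟨a, c, h⟩ := IsAff.diff hf hg
  refine ⟨[(a, -c)], rfl, fun x => ?_⟩
  have := h x
  simp only [List.mem_singleton, forall_eq]
  constructor <;> intro _ <;> linarith

theorem IsLin.and {p q : ℕ} {P Q : (V → ℤ) → Prop} (hP : IsLin p P) (hQ : IsLin q Q) :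
    IsLin (p + q) (fun x => P x ∧ Q x) := by
  obtain ⟨l, hl, h⟩ := hP
  obtain ⟨l', hl', h'⟩ := hQ
  refine ⟨l ++ l', by simp [hl, hl'], fun x => ?_⟩
  simp only [h, h', List.mem_append]
  constructor
  · rintro ⟨h1, h2⟩ e (he | he)
    · exact h1 e he
    · exact h2 e he
  · intro h3
    exact ⟨fun e he => h3 e (Or.inl he), fun e he => h3 e (Or.inr he)⟩

theorem IsLin.eq {f g : (V → ℤ) → ℤ} (hf : IsAff f) (hg : IsAff g) :
    IsLin 2 (fun x => f x = g x) := by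
  have := IsLin.and (IsLin.le hf hg) (IsLin.le hg hf)
  simpa only [← le_antisymm_iff] using this

theorem IsLin.forall_fin {q : ℕ} : ∀ {L : ℕ} {P : Fin L → (V → ℤ) → Prop},
    (∀ d, IsLin q (P d)) → IsLin (L * q) (fun x => ∀ d, P d x) := by
  intro L
  induction L with
  | zero => intro P _; exact ⟨[], by simp, fun x => by simp⟩
  | succ L ih =>
    intro P hP
    have h := IsLin.and (ih (P := fun d => P d.castSucc) (fun d => hP _)) (hP (Fin.last L))
    have e : (L + 1) * q = L * q + q := by ring
    rw [e]
    simpa only [Fin.forall_fin_succ'] using h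

end LinSys

/-! ### Packing -/

/-- Base at level `d`. -/
def bs (W : ℤ) (d : ℕ) : ℤ := (W ^ 4) ^ (2 ^ d)

theorem bs_succ (W : ℤ) (d : ℕ) : bs W (d + 1) = bs W d * bs W d := by
  unfold bs; rw [pow_succ 2 d, pow_mul, sq]

/-- Packed value of the `2 ^ d` digits in block `q`. -/
def pk (W : ℤ) (F : ℕ → ℤ) : ℕ → ℕ → ℤ
  | 0, q => F q
  | d + 1, q => pk W F d (2 * q) + bs W d * pk W F d (2 * q + 1)

theorem mix_bound {B a b : ℤ} (ha : 0 ≤ a) (ha' : a ≤ B - 1) (hb : 0 ≤ b) (hb' : b ≤ B - 1) :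
    0 ≤ a + B * b ∧ a + B * b ≤ B * B - 1 := by
  constructor <;> nlinarith

theorem mix_uniq {B a b a' b' : ℤ} (ha : 0 ≤ a) (ha' : a ≤ B - 1) (hb : 0 ≤ a')
    (hb' : a' ≤ B - 1) (h : a + B * b = a' + B * b') : a = a' ∧ b = b' := by
  have hB : 0 < B := by linarith
  have h1 : a = a' := by
    have e1 : (a + B * b) % B = a := by
      rw [Int.add_mul_emod_self_left]; exact Int.emod_eq_of_lt ha (by linarith)
    have e2 : (a' + B * b') % B = a' := by
      rw [Int.add_mul_emod_self_left]; exact Int.emod_eq_of_lt hb (by linarith)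
    rw [← e1, ← e2, h]
  subst h1
  exact ⟨rfl, mul_left_cancel₀ hB.ne' (by linarith)⟩

theorem pk_bound {W : ℤ} {F : ℕ → ℤ} (hF : ∀ i, 0 ≤ F i ∧ F i ≤ W ^ 4 - 1) :
    ∀ d q, 0 ≤ pk W F d q ∧ pk W F d q ≤ bs W d - 1 := by
  intro d
  induction d with
  | zero => intro q; simpa [pk, bs] using hF q
  | succ d ih =>
    intro q
    rw [bs_succ]
    exact mix_bound (ih _).1 (ih _).2 (ih _).1 (ih _).2

/-- One selection step. -/
def StepOK (B s s' r b : ℤ) : Prop :=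
  b ≤ 1 ∧ s' ≤ B - 1 ∧ r ≤ B - 1 ∧
  s - (s' + B * r) ≤ B * B * b ∧ (s' + B * r) - s ≤ B * B * b ∧
  s - (r + B * s') ≤ B * B * (1 - b) ∧ (r + B * s') - s ≤ B * B * (1 - b)

/-- The whole system. -/
def Good (L : ℕ) (W Z : ℤ) (y : Fin 3 → ℤ) (S : Fin (L + 1) → ℤ) (R b : Fin L → ℤ)
    (u χ : Fin 4 → ℤ) : Prop :=
  S (Fin.last L) = Z ∧
  (∀ d : Fin L, StepOK (bs W d) (S d.succ) (S d.castSucc) (R d) (b d)) ∧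
  (u 0 ≤ W - 1 ∧ u 1 ≤ W - 1 ∧ u 2 ≤ W - 1 ∧
    S 0 = u 0 + W * (u 1 + W * (u 2 + W * u 3))) ∧
  (χ 0 + χ 1 + χ 2 + χ 3 ≤ 1 ∧ y 2 = 1 - χ 0 - χ 1 - χ 2 ∧
    y 0 - u 0 ≤ W * (1 - χ 0) ∧ u 0 - y 0 ≤ W * (1 - χ 0) ∧
    y 0 - u 1 ≤ W * (1 - χ 1) ∧ u 1 - y 0 ≤ W * (1 - χ 1) ∧
    y 0 - u 2 ≤ W * (1 - χ 2) ∧ u 2 - y 0 ≤ W * (1 - χ 2) ∧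
    y 0 ≤ W * (χ 0 + χ 1 + χ 2) ∧
    y 1 - u 3 ≤ 2 * W * (1 - χ 0 - χ 1 - χ 3) ∧ u 3 - y 1 ≤ 2 * W * (1 - χ 0 - χ 1 - χ 3) ∧
    y 1 - 2 * u 3 ≤ 2 * W * (1 - χ 2) ∧ 2 * u 3 - y 1 ≤ 2 * W * (1 - χ 2) ∧
    y 1 ≤ 2 * W * (χ 0 + χ 1 + χ 2 + χ 3))

theorem good_lin {V : Type} [Fintype V] (L : ℕ) (W Z : ℤ) (y : Fin 3 → V) (S : Fin (L + 1) → V)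
    (R b : Fin L → V) (u χ : Fin 4 → V) :
    IsLin (2 + (L * 7 + (5 + 15))) (fun x : V → ℤ =>
      Good L W Z (fun k => x (y k)) (fun k => x (S k)) (fun k => x (R k)) (fun k => x (b k))
        (fun k => x (u k)) (fun k => x (χ k))) := by
  unfold Good StepOK
  refine IsLin.and (IsLin.eq ?_ ?_) (IsLin.and (IsLin.forall_fin fun d => ?_) (IsLin.and ?_ ?_))
  rotate_left 2
  · refine IsLin.and (p := 1) (q := 6) (IsLin.le ?_ ?_) (IsLin.and (p := 1) (q := 5) (IsLin.le ?_ ?_)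
      (IsLin.and (p := 1) (q := 4) (IsLin.le ?_ ?_) (IsLin.and (p := 1) (q := 3) (IsLin.le ?_ ?_)
      (IsLin.and (p := 1) (q := 2) (IsLin.le ?_ ?_) (IsLin.and (p := 1) (q := 1) (IsLin.le ?_ ?_)
      (IsLin.le ?_ ?_)))))) <;>
    repeat' first
      | exact IsAff.const _ | exact IsAff.coord _ | apply IsAff.diff | apply IsAff.sum
      | apply IsAff.smul
  · refine IsLin.and (p := 1) (q := 4) (IsLin.le ?_ ?_) (IsLin.and (p := 1) (q := 3) (IsLin.le ?_ ?_)
      (IsLin.and (p := 1) (q := 2) (IsLin.le ?_ ?_) (IsLin.eq ?_ ?_))) <;>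
    repeat' first
      | exact IsAff.const _ | exact IsAff.coord _ | apply IsAff.diff | apply IsAff.sum
      | apply IsAff.smul
  · refine IsLin.and (p := 1) (q := 14) (IsLin.le ?_ ?_) (IsLin.and (p := 2) (q := 12)
      (IsLin.eq ?_ ?_) (IsLin.and (p := 1) (q := 11) (IsLin.le ?_ ?_)
      (IsLin.and (p := 1) (q := 10) (IsLin.le ?_ ?_) (IsLin.and (p := 1) (q := 9) (IsLin.le ?_ ?_)
      (IsLin.and (p := 1) (q := 8) (IsLin.le ?_ ?_) (IsLin.and (p := 1) (q := 7) (IsLin.le ?_ ?_)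
      (IsLin.and (p := 1) (q := 6) (IsLin.le ?_ ?_) (IsLin.and (p := 1) (q := 5) (IsLin.le ?_ ?_)
      (IsLin.and (p := 1) (q := 4) (IsLin.le ?_ ?_) (IsLin.and (p := 1) (q := 3) (IsLin.le ?_ ?_)
      (IsLin.and (p := 1) (q := 2) (IsLin.le ?_ ?_) (IsLin.and (p := 1) (q := 1) (IsLin.le ?_ ?_)
      (IsLin.le ?_ ?_))))))))))))) <;>
    repeat' first
      | exact IsAff.const _ | exact IsAff.coord _ | apply IsAff.diff | apply IsAff.sum
      | apply IsAff.smul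
  · exact IsAff.coord _
  · exact IsAff.const _

/-! ### Semantics -/

theorem step_sound {B s s' r b a0 a1 : ℤ} (hs' : 0 ≤ s') (hr : 0 ≤ r) (hb : 0 ≤ b)
    (h : StepOK B s s' r b) (hs : s = a0 + B * a1) (h0 : 0 ≤ a0) (h0' : a0 ≤ B - 1) :
    (b = 0 ∧ s' = a0 ∧ r = a1) ∨ (b = 1 ∧ s' = a1 ∧ r = a0) := by
  obtain ⟨h1, h2, h3, h4, h5, h6, h7⟩ := h
  obtain rfl | rfl : b = 0 ∨ b = 1 := by omega
  · left
    have := mix_uniq hs' h2 h0 h0' (b := r) (b' := a1) (by linarith)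
    exact ⟨rfl, this⟩
  · right
    have := mix_uniq hr h3 h0 h0' (b := s') (b' := a1) (by linarith)
    exact ⟨rfl, this.2, this.1⟩

theorem step_complete {B a0 a1 : ℤ} (h0 : 0 ≤ a0) (h0' : a0 ≤ B - 1)
    (h1 : 0 ≤ a1) (h1' : a1 ≤ B - 1) :
    StepOK B (a0 + B * a1) a0 a1 0 ∧ StepOK B (a0 + B * a1) a1 a0 1 := by
  have e1 := mix_bound h0 h0' h1 h1'
  have e2 := mix_bound h1 h1' h0 h0'
  unfold StepOK
  refine ⟨⟨?_, ?_, ?_, ?_, ?_, ?_, ?_⟩, ⟨?_, ?_, ?_, ?_, ?_, ?_, ?_⟩⟩ <;> linarith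

theorem exists_bits : ∀ (L : ℕ) (b : Fin L → ℤ), (∀ d, b d = 0 ∨ b d = 1) →
    ∃ i : ℕ, i < 2 ^ L ∧ ∀ d : Fin L, ((i / 2 ^ (d : ℕ) % 2 : ℕ) : ℤ) = b d := by
  intro L
  induction L with
  | zero => intro b _; exact ⟨0, by simp, fun d => d.elim0⟩
  | succ L ih =>
    intro b hb
    obtain ⟨i, hi, h⟩ := ih (fun d => b d.succ) (fun d => hb _)
    obtain ⟨c, hc, hc'⟩ : ∃ c : ℕ, c < 2 ∧ (c : ℤ) = b 0 := by
      rcases hb 0 with h0 | h0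
      · exact ⟨0, by norm_num, by simp [h0]⟩
      · exact ⟨1, by norm_num, by simp [h0]⟩
    refine ⟨2 * i + c, by rw [pow_succ]; omega, fun d => ?_⟩
    refine Fin.cases ?_ (fun d => ?_) d
    · rw [← hc']; simp; omega
    · rw [← h d]
      have : (2 * i + c) / 2 ^ ((d.succ : Fin (L + 1)) : ℕ) = i / 2 ^ (d : ℕ) := by
        rw [Fin.val_succ, pow_succ', ← Nat.div_div_eq_div_mul]
        congr 1; omega
      rw [this]

theorem bits_inj : ∀ (L i j : ℕ), i < 2 ^ L → j < 2 ^ L →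
    (∀ d < L, i / 2 ^ d % 2 = j / 2 ^ d % 2) → i = j := by
  intro L
  induction L with
  | zero => intro i j hi hj _; simp at hi hj; omega
  | succ L ih =>
    intro i j hi hj h
    rw [pow_succ] at hi hj
    have h0 := h 0 (by omega)
    simp at h0
    have := ih (i / 2) (j / 2) (by omega) (by omega) (fun d hd => by
      have := h (d + 1) (by omega)
      rwa [pow_succ', ← Nat.div_div_eq_div_mul, ← Nat.div_div_eq_div_mul] at this)
    omega

/-- The values of the intermediate variables. -/
def vS (W : ℤ) (F : ℕ → ℤ) (i d : ℕ) : ℤ := pk W F d (i / 2 ^ d)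
def vB (i d : ℕ) : ℤ := ((i / 2 ^ d % 2 : ℕ) : ℤ)
def vR (W : ℤ) (F : ℕ → ℤ) (i d : ℕ) : ℤ :=
  pk W F d (2 * (i / 2 ^ (d + 1)) + (1 - i / 2 ^ d % 2))

/-- Packed digit. -/
def dig (W : ℤ) (f : Fin 4 → ℕ → ℤ) (i : ℕ) : ℤ :=
  f 0 i + W * (f 1 i + W * (f 2 i + W * f 3 i))

theorem dig_bound {W : ℤ} {f : Fin 4 → ℕ → ℤ} (hf : ∀ k i, 0 ≤ f k i ∧ f k i ≤ W - 1) (i : ℕ) :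
    0 ≤ dig W f i ∧ dig W f i ≤ W ^ 4 - 1 := by
  unfold dig
  have h0 := hf 0 i
  have h1 := hf 1 i
  have h2 := hf 2 i
  have h3 := hf 3 i
  have hW : 0 ≤ W := by linarith
  have a := mix_bound h2.1 h2.2 h3.1 h3.2
  have key : ∀ {a t C : ℤ}, 0 ≤ a → a ≤ W - 1 → 0 ≤ t → t ≤ C - 1 →
      0 ≤ a + W * t ∧ a + W * t ≤ W * C - 1 := by
    intro a t C p1 p2 p3 p4
    constructor <;> nlinarith
  have b := key h1.1 h1.2 a.1 a.2
  have c := key h0.1 h0.2 b.1 b.2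
  refine ⟨c.1, c.2.trans (le_of_eq (by ring))⟩

theorem half_cases (i d : ℕ) :
    (i / 2 ^ d % 2 = 0 ∧ i / 2 ^ d = 2 * (i / 2 ^ (d + 1))) ∨
    (i / 2 ^ d % 2 = 1 ∧ i / 2 ^ d = 2 * (i / 2 ^ (d + 1)) + 1) := by
  have : i / 2 ^ (d + 1) = i / 2 ^ d / 2 := by
    rw [pow_succ, ← Nat.div_div_eq_div_mul]
  rw [this]
  omega

/-- First three coordinates. -/
def al (f : Fin 4 → ℕ → ℤ) (i : ℕ) (t : Fin 5) : Fin 3 → ℤ :=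
  ![![f 0 i, f 3 i, 0], ![f 1 i, f 3 i, 0], ![f 2 i, 2 * f 3 i, 0], ![0, f 3 i, 1], ![0, 0, 1]] t

theorem good_complete (L : ℕ) (W : ℤ) (f : Fin 4 → ℕ → ℤ)
    (hf : ∀ k i, 0 ≤ f k i ∧ f k i ≤ W - 1) (i : ℕ) (hi : i < 2 ^ L) (t : Fin 5) :
    Good L W (pk W (dig W f) L 0) (al f i t) (fun d => vS W (dig W f) i d)
      (fun d => vR W (dig W f) i d) (fun d => vB i d) (fun k => f k i)
      (fun j => if (t : ℕ) = (j : ℕ) then 1 else 0) := by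
  have hpk := pk_bound (dig_bound hf)
  refine ⟨?_, ?_, ⟨(hf 0 i).2, (hf 1 i).2, (hf 2 i).2, ?_⟩, ?_⟩
  · simp [vS, Nat.div_eq_of_lt hi]
  · intro d
    have hc := step_complete (hpk d (2 * (i / 2 ^ ((d : ℕ) + 1)))).1
      (hpk d (2 * (i / 2 ^ ((d : ℕ) + 1)))).2
      (hpk d (2 * (i / 2 ^ ((d : ℕ) + 1)) + 1)).1 (hpk d (2 * (i / 2 ^ ((d : ℕ) + 1)) + 1)).2
    simp only [vS, vR, vB, Fin.val_succ, Fin.val_castSucc, pk]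
    rcases half_cases i d with ⟨h1, h2⟩ | ⟨h1, h2⟩
    · rw [h1, h2]; simpa using hc.1
    · rw [h1, h2]; simpa using hc.2
  · simp [vS, pk, dig]
  · have h0 := hf 0 i
    have h1 := hf 1 i
    have h2 := hf 2 i
    have h3 := hf 3 i
    fin_cases t <;> simp [al] <;> omega

theorem good_sound (L : ℕ) (W : ℤ) (f : Fin 4 → ℕ → ℤ)
    (hf : ∀ k i, 0 ≤ f k i ∧ f k i ≤ W - 1)
    (y : Fin 3 → ℤ) (S : Fin (L + 1) → ℤ) (R b : Fin L → ℤ) (u χ : Fin 4 → ℤ)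
    (hy : ∀ k, 0 ≤ y k) (hS : ∀ k, 0 ≤ S k) (hR : ∀ k, 0 ≤ R k) (hb : ∀ k, 0 ≤ b k)
    (hu : ∀ k, 0 ≤ u k) (hχ : ∀ k, 0 ≤ χ k)
    (h : Good L W (pk W (dig W f) L 0) y S R b u χ) :
    ∃ i : ℕ, i < 2 ^ L ∧ ∃ t : Fin 5, y = al f i t ∧ (S = fun d : Fin (L + 1) => vS W (dig W f) i d) ∧
      (R = fun d : Fin L => vR W (dig W f) i d) ∧ (b = fun d : Fin L => vB i d) ∧ (u = fun k => f k i) ∧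
      (χ = fun j : Fin 4 => if (t : ℕ) = (j : ℕ) then 1 else 0) := by
  have hpk := pk_bound (dig_bound hf)
  obtain ⟨hZ, hst, ⟨hu0, hu1, hu2, hu3⟩, hfin⟩ := h
  have hb01 : ∀ d, b d = 0 ∨ b d = 1 := fun d => by
    have := hb d
    have := (hst d).1
    omega
  obtain ⟨i, hi, hbit⟩ := exists_bits L b hb01
  have key : ∀ d : Fin L, S d.succ = vS W (dig W f) i (d.succ : Fin (L + 1)) →
      S d.castSucc = vS W (dig W f) i (d.castSucc : Fin (L + 1)) ∧ R d = vR W (dig W f) i d := by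
    intro d hd
    have hs := step_sound (hS _) (hR _) (hb _) (hst d)
      (a0 := pk W (dig W f) d (2 * (i / 2 ^ ((d : ℕ) + 1))))
      (a1 := pk W (dig W f) d (2 * (i / 2 ^ ((d : ℕ) + 1)) + 1))
      (by rw [hd]; simp [vS, pk]) (hpk _ _).1 (hpk _ _).2
    have hbd := hbit d
    simp only [vS, vR, Fin.val_castSucc]
    rcases half_cases i d with ⟨h1, h2⟩ | ⟨h1, h2⟩
    · rw [h1] at hbd
      rw [h1, h2]
      rcases hs with ⟨e1, e2, e3⟩ | ⟨e1, e2, e3⟩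
      · exact ⟨e2, e3⟩
      · rw [e1] at hbd; simp at hbd
    · rw [h1] at hbd
      rw [h1, h2]
      rcases hs with ⟨e1, e2, e3⟩ | ⟨e1, e2, e3⟩
      · rw [e1] at hbd; simp at hbd
      · exact ⟨e2, e3⟩
  have hSall : ∀ d : Fin (L + 1), S d = vS W (dig W f) i d := by
    intro d
    induction d using Fin.reverseInduction with
    | last => rw [hZ]; simp [vS, Nat.div_eq_of_lt hi]
    | cast d ih => exact (key d ih).1
  have hu' : u = fun k => f k i := by
    have h0 := hSall 0
    rw [hu3] at h0
    simp only [vS, pk, dig, Fin.val_zero, pow_zero, Nat.div_one] at h0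
    obtain ⟨e0, h0⟩ := mix_uniq (hu 0) hu0 (hf 0 i).1 (hf 0 i).2 h0
    obtain ⟨e1, h0⟩ := mix_uniq (hu 1) hu1 (hf 1 i).1 (hf 1 i).2 h0
    obtain ⟨e2, h0⟩ := mix_uniq (hu 2) hu2 (hf 2 i).1 (hf 2 i).2 h0
    funext k
    fin_cases k
    · exact e0
    · exact e1
    · exact e2
    · exact h0
  refine ⟨i, hi, ?_⟩
  suffices ∃ t : Fin 5, y = al f i t ∧ (χ = fun j : Fin 4 => if (t : ℕ) = (j : ℕ) then 1 else 0) by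
    obtain ⟨t, e1, e2⟩ := this
    exact ⟨t, e1, funext hSall, funext fun d => (key d (hSall _)).2,
      funext fun d => (hbit d).symm, hu', e2⟩
  subst hu'
  obtain ⟨g1, g2, g3, g4, g5, g6, g7, g8, g9, g10, g11, g12, g13, g14⟩ := hfin
  have c0 := hχ 0
  have c1 := hχ 1
  have c2 := hχ 2
  have c3 := hχ 3
  have y0 := hy 0
  have y1 := hy 1
  have fin3 : ∀ z : Fin 3 → ℤ, y 0 = z 0 → y 1 = z 1 → y 2 = z 2 → y = z := by
    intro z a b c
    funext k
    fin_cases k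
    · exact a
    · exact b
    · exact c
  have fin4 : ∀ z : Fin 4 → ℤ, χ 0 = z 0 → χ 1 = z 1 → χ 2 = z 2 → χ 3 = z 3 → χ = z := by
    intro z a b c d
    funext k
    fin_cases k
    · exact a
    · exact b
    · exact c
    · exact d
  have cs : (χ 0 = 1 ∧ χ 1 = 0 ∧ χ 2 = 0 ∧ χ 3 = 0) ∨ (χ 0 = 0 ∧ χ 1 = 1 ∧ χ 2 = 0 ∧ χ 3 = 0) ∨
      (χ 0 = 0 ∧ χ 1 = 0 ∧ χ 2 = 1 ∧ χ 3 = 0) ∨ (χ 0 = 0 ∧ χ 1 = 0 ∧ χ 2 = 0 ∧ χ 3 = 1) ∨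
      (χ 0 = 0 ∧ χ 1 = 0 ∧ χ 2 = 0 ∧ χ 3 = 0) := by
    clear g3 g4 g5 g6 g7 g8 g9 g10 g11 g12 g13 g14
    omega
  rcases cs with ⟨q0, q1, q2, q3⟩ | ⟨q0, q1, q2, q3⟩ | ⟨q0, q1, q2, q3⟩ | ⟨q0, q1, q2, q3⟩ |
    ⟨q0, q1, q2, q3⟩ <;> rw [q0, q1, q2] at g2 <;>
    simp only [q0, q1, q2, q3] at g3 g4 g5 g6 g7 g8 g9 g10 g11 g12 g13 g14
  · refine ⟨0, fin3 _ ?_ ?_ ?_, fin4 _ ?_ ?_ ?_ ?_⟩ <;> simp [al, *] <;> linarith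
  · refine ⟨1, fin3 _ ?_ ?_ ?_, fin4 _ ?_ ?_ ?_ ?_⟩ <;> simp [al, *] <;> linarith
  · refine ⟨2, fin3 _ ?_ ?_ ?_, fin4 _ ?_ ?_ ?_ ?_⟩ <;> simp [al, *] <;> linarith
  · refine ⟨3, fin3 _ ?_ ?_ ?_, fin4 _ ?_ ?_ ?_ ?_⟩ <;> simp [al, *] <;> linarith
  · refine ⟨4, fin3 _ ?_ ?_ ?_, fin4 _ ?_ ?_ ?_ ?_⟩ <;> simp [al, *] <;> linarith

/-- Index type of the auxiliary variables. -/
abbrev Aux (L : ℕ) : Type := Fin (L + 1) ⊕ Fin L ⊕ Fin L ⊕ Fin 4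

/-- Values of the auxiliary variables. -/
def bet (L : ℕ) (W : ℤ) (f : Fin 4 → ℕ → ℤ) (i : ℕ) : Aux L → ℤ :=
  Sum.elim (fun d => vS W (dig W f) i d) (Sum.elim (fun d => vR W (dig W f) i d)
    (Sum.elim (fun d => vB i d) (fun k => f k i)))

theorem core (L : ℕ) (hL : 1 ≤ L) (W : ℤ) (f : Fin 4 → ℕ → ℤ)
    (hf : ∀ k i, 0 ≤ f k i ∧ f k i ≤ W - 1) :
    ∃ p q : ℕ, p ≤ 30 * L ∧ q ≤ 30 * L ∧
      ∃ (A : Fin q → (Fin 3 ⊕ Fin p ⊕ Fin 4) → ℤ) (b : Fin q → ℤ)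
        (β : Fin (2 ^ L) → Fin p → ℤ),
        Function.Injective β ∧ (∀ i j, 0 ≤ β i j) ∧
        {x : (Fin 3 ⊕ Fin p ⊕ Fin 4) → ℤ |
            (∀ idx, 0 ≤ x idx) ∧ ∀ row, (∑ idx, A row idx * x idx) ≤ b row}
          = {x | ∃ (i : Fin (2 ^ L)) (t : Fin 5),
              x = Sum.elim (al f i t) (Sum.elim (β i)
                  (fun j4 : Fin 4 => if (t : ℕ) = (j4 : ℕ) then 1 else 0))} := by
  have hpk := pk_bound (dig_bound hf)
  let p := Fintype.card (Aux L)
  have hp : p = 3 * L + 5 := by simp [p]; ring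
  let e : Aux L ≃ Fin p := Fintype.equivFin (Aux L)
  obtain ⟨l, hl, h⟩ := good_lin (V := Fin 3 ⊕ Fin p ⊕ Fin 4) L W (pk W (dig W f) L 0)
    (fun k => Sum.inl k) (fun k => Sum.inr (Sum.inl (e (Sum.inl k))))
    (fun k => Sum.inr (Sum.inl (e (Sum.inr (Sum.inl k)))))
    (fun k => Sum.inr (Sum.inl (e (Sum.inr (Sum.inr (Sum.inl k))))))
    (fun k => Sum.inr (Sum.inl (e (Sum.inr (Sum.inr (Sum.inr k))))))
    (fun k => Sum.inr (Sum.inr k))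
  have hbet : ∀ i a, 0 ≤ bet L W f i a := by
    intro i a
    rcases a with d | d | d | k
    · exact (hpk _ _).1
    · exact (hpk _ _).1
    · exact Int.natCast_nonneg _
    · exact (hf k i).1
  refine ⟨p, l.length, by omega, by omega, fun r => (l.get r).1, fun r => (l.get r).2,
    fun i a => bet L W f i (e.symm a), ?_, fun i j => hbet _ _, ?_⟩
  · intro i j hij
    apply Fin.ext
    refine bits_inj L i j i.2 j.2 fun d hd => ?_
    have := congrFun hij (e (Sum.inr (Sum.inr (Sum.inl ⟨d, hd⟩))))
    simp only [bet, vB, Equiv.symm_apply_apply, Sum.elim_inr, Sum.elim_inl] at this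
    exact_mod_cast this
  · ext x
    have hx : (∀ row : Fin l.length, ∑ idx, (l.get row).1 idx * x idx ≤ (l.get row).2) ↔
        ∀ e ∈ l, ∑ i, e.1 i * x i ≤ e.2 := by
      rw [List.forall_mem_iff_get]
    simp only [Set.mem_ofPred_eq]
    rw [hx, ← h x]
    constructor
    · rintro ⟨h0, hG⟩
      obtain ⟨i, hi, t, e1, e2, e3, e4, e5, e6⟩ := good_sound L W f hf _ _ _ _ _ _
        (fun k => h0 _) (fun k => h0 _) (fun k => h0 _) (fun k => h0 _) (fun k => h0 _)
        (fun k => h0 _) hG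
      refine ⟨⟨i, hi⟩, t, ?_⟩
      funext v
      rcases v with k | a | k
      · exact congrFun e1 k
      · obtain ⟨a, rfl⟩ := e.surjective a
        simp only [Sum.elim_inr, Sum.elim_inl, Equiv.symm_apply_apply]
        rcases a with d | d | d | k
        · exact congrFun e2 d
        · exact congrFun e3 d
        · exact congrFun e4 d
        · exact congrFun e5 k
      · exact congrFun e6 k
    · rintro ⟨i, t, rfl⟩
      refine ⟨?_, ?_⟩
      · rintro (k | a | k)
        · have h0 := (hf 0 i).1
          have h1 := (hf 1 i).1
          have h2 := (hf 2 i).1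
          have h3 := (hf 3 i).1
          fin_cases t <;> fin_cases k <;> simp [al, *]
        · exact hbet _ _
        · simp only [Sum.elim_inr]
          split_ifs <;> norm_num
      · simpa [bet] using good_complete L W f hf i i.2 t

theorem sol_ncard {n p : ℕ} (a : Fin n → Fin 5 → Fin 3 → ℤ) (β : Fin n → Fin p → ℤ)
    (hβ : Function.Injective β) :
    Set.ncard {x : (Fin 3 ⊕ Fin p ⊕ Fin 4) → ℤ | ∃ (i : Fin n) (t : Fin 5),
              x = Sum.elim (a i t) (Sum.elim (β i)
                  (fun j4 : Fin 4 => if (t : ℕ) = (j4 : ℕ) then 1 else 0))} = 5 * n := by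
  let g : Fin n × Fin 5 → (Fin 3 ⊕ Fin p ⊕ Fin 4) → ℤ := fun z =>
    Sum.elim (a z.1 z.2) (Sum.elim (β z.1)
                  (fun j4 : Fin 4 => if (z.2 : ℕ) = (j4 : ℕ) then 1 else 0))
  have hg : Function.Injective g := by
    rintro ⟨i, t⟩ ⟨j, s⟩ hz
    have h1 : i = j := hβ (funext fun k => congrFun hz (Sum.inr (Sum.inl k)))
    have h2 : ∀ k : Fin 4, (if (t : ℕ) = (k : ℕ) then (1 : ℤ) else 0) =
        if (s : ℕ) = (k : ℕ) then 1 else 0 := fun k => congrFun hz (Sum.inr (Sum.inr k))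
    have h3 : t = s := by
      revert h2
      revert t s
      intro t s _ h2
      fin_cases t <;> fin_cases s <;> first | rfl | (simp [Fin.forall_fin_succ] at h2)
    rw [h1, h3]
  have hS : {x : (Fin 3 ⊕ Fin p ⊕ Fin 4) → ℤ | ∃ (i : Fin n) (t : Fin 5),
              x = Sum.elim (a i t) (Sum.elim (β i)
                  (fun j4 : Fin 4 => if (t : ℕ) = (j4 : ℕ) then 1 else 0))} = Set.image g Set.univ := by
    ext x
    simp only [Set.mem_ofPred_eq, Set.image_univ, Set.mem_range, Prod.exists, g]
    constructor
    · rintro ⟨i, t, h⟩; exact ⟨i, t, h.symm⟩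
    · rintro ⟨i, t, h⟩; exact ⟨i, t, h.symm⟩
  rw [hS, Set.ncard_image_of_injective _ hg, Set.ncard_univ]
  simp [mul_comm]

/-- There is an absolute constant `c > 0` such that for every
well-structured 3-CNF instance (with `n ≥ 2` a power of two, `m ≥ 1`, `γ > 3`)
there is an ILP `A x ≤ b` over `ℤ_{≥0}^{3+p+4}` with `p, q ≤ c·log₂ n` and an
injective `β : {0,…,n−1} → ℤ_{≥0}^p` whose solution set consists exactly of the
`5n` vectors `(α_t(i), β(i), χ_t)`. -/
theorem compact_ilp_exists :
    ∃ c : ℕ, 0 < c ∧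
      ∀ (L n m γ : ℕ) (φ : Cnf3) (jIdx kIdx lIdx : ℕ → ℕ),
        n = 2 ^ L → 2 ≤ n → 1 ≤ m → 3 < γ →
        φ.numVars = n → φ.numClauses = m →
        φ.WellStructured →
        (∀ i < n, jIdx i < m ∧ kIdx i < m ∧ lIdx i < m) →
        (∀ i < n,
          (∀ cl, φ.clauseOcc cl i true =
            (if jIdx i = cl then 1 else 0) + (if kIdx i = cl then 1 else 0)) ∧
          (∀ cl, φ.clauseOcc cl i false = (if lIdx i = cl then 1 else 0))) →
        ∃ p q : ℕ, p ≤ c * Nat.log 2 n ∧ q ≤ c * Nat.log 2 n ∧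
          ∃ (A : Fin q → (Fin 3 ⊕ Fin p ⊕ Fin 4) → ℤ) (b : Fin q → ℤ)
            (β : Fin n → Fin p → ℤ),
            Function.Injective β ∧ (∀ i j, 0 ≤ β i j) ∧
            {x : (Fin 3 ⊕ Fin p ⊕ Fin 4) → ℤ |
                (∀ idx, 0 ≤ x idx) ∧ ∀ row, (∑ idx, A row idx * x idx) ≤ b row}
              = {x | ∃ (i : Fin n) (t : Fin 5),
                  x = Sum.elim
                    (![![(γ : ℤ) ^ jIdx (i : ℕ), (γ : ℤ) ^ (i : ℕ), 0],
                       ![(γ : ℤ) ^ kIdx (i : ℕ), (γ : ℤ) ^ (i : ℕ), 0],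
                       ![(γ : ℤ) ^ lIdx (i : ℕ), 2 * (γ : ℤ) ^ (i : ℕ), 0],
                       ![0, (γ : ℤ) ^ (i : ℕ), 1],
                       ![0, 0, 1]] t)
                    (Sum.elim (β i)
                      (fun j4 : Fin 4 => if (t : ℕ) = (j4 : ℕ) then 1 else 0))} ∧
            Set.ncard {x : (Fin 3 ⊕ Fin p ⊕ Fin 4) → ℤ |
                (∀ idx, 0 ≤ x idx) ∧ ∀ row, (∑ idx, A row idx * x idx) ≤ b row}
              = 5 * n := by
  refine ⟨30, by norm_num, ?_⟩
  intro L n m γ φ jIdx kIdx lIdx hn hn2 _ hγ _ _ _ hlt _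
  subst hn
  have hL : 1 ≤ L := by
    rcases Nat.eq_zero_or_pos L with h | h
    · subst h; norm_num at hn2
    · exact h
  have hγ1 : (1 : ℤ) ≤ γ := by exact_mod_cast (by omega : 1 ≤ γ)
  let ex : Fin 4 → ℕ → ℕ := ![jIdx, kIdx, lIdx, fun i => i]
  let f : Fin 4 → ℕ → ℤ := fun k i => if i < 2 ^ L then (γ : ℤ) ^ ex k i else 0
  have hf : ∀ k i, 0 ≤ f k i ∧ f k i ≤ ((γ : ℤ) ^ (m + 2 ^ L) + 1) - 1 := by
    intro k i
    simp only [f]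
    split_ifs with hi
    · refine ⟨by positivity, ?_⟩
      rw [add_sub_cancel_right]
      apply pow_le_pow_right₀ hγ1
      obtain ⟨a, b, c⟩ := hlt i hi
      fin_cases k <;> simp [ex] <;> omega
    · refine ⟨le_refl _, ?_⟩
      rw [add_sub_cancel_right]
      positivity
  obtain ⟨p, q, hp, hq, A, b, β, hβ, hβ0, hset⟩ := core L hL _ f hf
  have hlog : Nat.log 2 (2 ^ L) = L := Nat.log_pow (by norm_num) L
  refine ⟨p, q, by rwa [hlog], by rwa [hlog], A, b, β, hβ, hβ0, ?_, ?_⟩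
  · rw [hset]
    simp only [al, f, ex, Fin.is_lt, if_true]
    rfl
  · rw [hset]
    exact sol_ncard (fun i t => al f i t) β hβ
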